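/- For all integers n ≥ 6 and k ≥ 3, the counts J^P and J^A satisfy the same three-term recurrence: J^P_{k,n} = J^P_{k−2,n−3} + J^P_{k−2,n−4} + J^P_{k−3,n−5} and J^A_{k,n} = J^A_{k−2,n−3} + J^A_{k−2,n−4} + J^A_{k−3,n−5}. -/

import Mathlib

open Filter

/-- A configuration of length `n`: lots are indexed `1,…,n`; houses may only stand there. -/
def InRange (n : ℕ) (c : ℕ → Bool) : Prop := ∀ i, c i = true → 1 ≤ i ∧ i ≤ n

/-- Lot `i` receives sunlight: it is a boundary lot, or one of its neighbours is empty. -/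
def Sun (n : ℕ) (c : ℕ → Bool) (i : ℕ) : Prop :=
  i = 1 ∨ i = n ∨ c (i - 1) = false ∨ c (i + 1) = false

/-- Every occupied lot receives sunlight. -/
def Permissible (n : ℕ) (c : ℕ → Bool) : Prop := ∀ i, c i = true → Sun n c i

/-- The configuration obtained by occupying lot `j`. -/
def occupy (c : ℕ → Bool) (j : ℕ) : ℕ → Bool := fun i => if i = j then true else c i

/-- Maximal (jammed): permissible, and occupying any empty lot breaks permissibility. -/
def IsMaximal (n : ℕ) (c : ℕ → Bool) : Prop :=
  Permissible n c ∧ ∀ j, 1 ≤ j → j ≤ n → c j = false → ¬ Permissible n (occupy c j)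

/-- Resistant to predators: a house built on any empty lot would get no sunlight. -/
def ResistPred (n : ℕ) (c : ℕ → Bool) : Prop :=
  ∀ j, 1 ≤ j → j ≤ n → c j = false → ¬ Sun n (occupy c j) j

/-- Resistant to altruists: a house built on any empty lot would cut off sunlight
from some other occupied lot. -/
def ResistAlt (n : ℕ) (c : ℕ → Bool) : Prop :=
  ∀ j, 1 ≤ j → j ≤ n → c j = false →
    ∃ i, i ≠ j ∧ c i = true ∧ ¬ Sun n (occupy c j) i

/-- Number of occupied lots. -/
def occ (n : ℕ) (c : ℕ → Bool) : ℕ :=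
  ((Finset.Icc 1 n).filter (fun i => c i = true)).card

/-- `JP k n`: number of maximal configurations of length `n` with `k` occupied lots
that are resistant to predators. -/
noncomputable def JP (k n : ℕ) : ℕ :=
  Nat.card {c : ℕ → Bool //
    InRange n c ∧ IsMaximal n c ∧ ResistPred n c ∧ occ n c = k}

/-- `JA k n`: number of maximal configurations of length `n` with `k` occupied lots
that are resistant to altruists. -/
noncomputable def JA (k n : ℕ) : ℕ :=
  Nat.card {c : ℕ → Bool //
    InRange n c ∧ IsMaximal n c ∧ ResistAlt n c ∧ occ n c = k}


section aux

def accW {σ : Type} (δ : σ → Bool → σ) (fin : σ → Bool) (c : ℕ → Bool) : σ → ℕ → ℕ → Bool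
  | q, _, 0 => fin q
  | q, i, r + 1 => accW δ fin c (δ q (c (i + 1))) (i + 1) r

def pushW (b : Bool) (c : ℕ → Bool) : ℕ → Bool
  | 0 => false
  | 1 => b
  | i + 2 => c (i + 1)

noncomputable def polyW {σ : Type} (δ : σ → Bool → σ) (fin : σ → Bool) :
    σ → ℕ → Polynomial ℕ
  | q, 0 => if fin q then 1 else 0
  | q, n + 1 => polyW δ fin (δ q false) n + Polynomial.X * polyW δ fin (δ q true) n

lemma accW_push {σ : Type} (δ : σ → Bool → σ) (fin : σ → Bool) (b : Bool) (c : ℕ → Bool)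
    (r : ℕ) : ∀ (q : σ) (i : ℕ), accW δ fin (pushW b c) q (i + 1) r = accW δ fin c q i r := by
  induction r with
  | zero => intro q i; rfl
  | succ r ih => intro q i; simp only [accW, ih]; rfl

lemma occ_eq (n : ℕ) (c : ℕ → Bool) :
    occ n c = ∑ i ∈ Finset.range n, (c (i + 1)).toNat := by
  unfold occ
  rw [Finset.card_filter, Finset.range_eq_Ico, Finset.sum_Ico_add' (fun i => (c i).toNat) 0 n 1]
  apply Finset.sum_congr
  · ext x; simp
  · intro i _; cases c i <;> simp

lemma occ_push (n : ℕ) (b : Bool) (c : ℕ → Bool) :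
    occ (n + 1) (pushW b c) = occ n c + b.toNat := by
  rw [occ_eq, occ_eq, Finset.sum_range_succ']
  rfl

lemma finite_inRange (n : ℕ) : Finite {c : ℕ → Bool // InRange n c} := by
  apply Finite.of_injective (β := Fin (n + 1) → Bool) (fun c i => c.1 i)
  intro c d h
  apply Subtype.ext
  funext i
  by_cases hi : i < n + 1
  · exact congrFun h ⟨i, hi⟩
  · have h1 := c.2 i
    have h2 := d.2 i
    cases hc : c.1 i <;> cases hd : d.1 i <;> grind

lemma finite_inRange' (n : ℕ) (Q : (ℕ → Bool) → Prop) :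
    Finite {c : ℕ → Bool // InRange n c ∧ Q c} := by
  have := finite_inRange n
  exact Finite.of_injective
    (fun c : {c : ℕ → Bool // InRange n c ∧ Q c} =>
      (⟨c.1, c.2.1⟩ : {c : ℕ → Bool // InRange n c}))
    (fun c d h => Subtype.ext (Subtype.mk.inj h))

lemma inRange_push (n : ℕ) (b : Bool) (c : ℕ → Bool) (h : InRange n c) :
    InRange (n + 1) (pushW b c) := by
  intro i hi
  match i, hi with
  | 1, _ => omega
  | i + 2, hi => have := h (i + 1) hi; omega

def popW (c : ℕ → Bool) : ℕ → Bool
  | 0 => false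
  | i + 1 => c (i + 2)

lemma push_pop (n : ℕ) (c : ℕ → Bool) (h : InRange n c) : pushW (c 1) (popW c) = c := by
  funext i
  match i with
  | 0 =>
    have := h 0
    cases hc : c 0
    · rfl
    · have := this hc; omega
  | 1 => rfl
  | i + 2 => rfl

lemma pop_push (n : ℕ) (b : Bool) (c : ℕ → Bool) (h : InRange n c) : popW (pushW b c) = c := by
  funext i
  match i with
  | 0 =>
    have := h 0
    cases hc : c 0
    · rfl
    · have := this hc; omega
  | i + 1 => rfl

lemma inRange_pop (n : ℕ) (c : ℕ → Bool) (h : InRange (n + 1) c) : InRange n (popW c) := by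
  intro i hi
  match i, hi with
  | i + 1, hi => have := h (i + 2) hi; omega

lemma card_split (n : ℕ) (Q : (ℕ → Bool) → Prop) :
    Nat.card {c : ℕ → Bool // InRange (n + 1) c ∧ Q c} =
      Nat.card {c : ℕ → Bool // InRange n c ∧ Q (pushW false c)} +
      Nat.card {c : ℕ → Bool // InRange n c ∧ Q (pushW true c)} := by
  have := finite_inRange' n (fun c => Q (pushW false c))
  have := finite_inRange' n (fun c => Q (pushW true c))
  rw [← Nat.card_sum]
  symm
  refine Nat.card_eq_of_bijective (fun s => Sum.elim
    (fun c => ⟨pushW false c.1, inRange_push n _ _ c.2.1, c.2.2⟩)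
    (fun c => ⟨pushW true c.1, inRange_push n _ _ c.2.1, c.2.2⟩) s) ⟨?_, ?_⟩
  · rintro (⟨c, hc⟩ | ⟨c, hc⟩) (⟨d, hd⟩ | ⟨d, hd⟩) h
    · have h' := congrArg (fun x => popW x.1) h
      simp only [Sum.elim_inl, pop_push n _ c hc.1, pop_push n _ d hd.1] at h'
      subst h'; rfl
    · have h' := congrArg (fun x => x.1 1) h
      simp [pushW] at h'
    · have h' := congrArg (fun x => x.1 1) h
      simp [pushW] at h'
    · have h' := congrArg (fun x => popW x.1) h
      simp only [Sum.elim_inr, pop_push n _ c hc.1, pop_push n _ d hd.1] at h'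
      subst h'; rfl
  · rintro ⟨c, hc⟩
    have hp := push_pop _ c hc.1
    cases h1 : c 1
    · rw [h1] at hp
      exact ⟨Sum.inl ⟨popW c, inRange_pop n c hc.1, by rw [hp]; exact hc.2⟩, Subtype.ext hp⟩
    · rw [h1] at hp
      exact ⟨Sum.inr ⟨popW c, inRange_pop n c hc.1, by rw [hp]; exact hc.2⟩, Subtype.ext hp⟩

lemma card_acc {σ : Type} (δ : σ → Bool → σ) (fin : σ → Bool) (n : ℕ) : ∀ (q : σ) (k : ℕ),
    Nat.card {c : ℕ → Bool // InRange n c ∧ (accW δ fin c q 0 n = true ∧ occ n c = k)} =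
      (polyW δ fin q n).coeff k := by
  induction n with
  | zero =>
    intro q k
    have hz : ∀ c, InRange 0 c ↔ c = fun _ => false := by
      intro c
      constructor
      · intro h; funext i
        have := h i
        cases hc : c i
        · rfl
        · have := this hc; omega
      · rintro rfl i hi; simp at hi
    simp only [hz, accW, polyW]
    by_cases hf : fin q = true ∧ k = 0
    · obtain ⟨hf, rfl⟩ := hf
      simp [hf, occ]
    · have : IsEmpty {c : ℕ → Bool // (c = fun _ => false) ∧ fin q = true ∧ occ 0 c = k} := by
        constructor
        rintro ⟨c, _, h1, h2⟩
        apply hf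
        refine ⟨h1, ?_⟩
        simp [occ] at h2
        exact h2.symm
      rw [Nat.card_of_isEmpty]
      split_ifs with h
      · rw [Polynomial.coeff_one, if_neg (fun h' => hf ⟨h, h'⟩)]
      · simp
  | succ n ih =>
    intro q k
    rw [card_split n (fun c => accW δ fin c q 0 (n + 1) = true ∧ occ (n + 1) c = k)]
    simp only [accW, accW_push, occ_push, polyW, Polynomial.coeff_add]
    have e1 : ∀ c b, pushW b c (0 + 1) = b := fun _ _ => rfl
    simp only [e1, Bool.toNat_false, Bool.toNat_true, add_zero, ih]
    congr 1
    cases k with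
    | zero => simp
    | succ k => simp [ih]

inductive QP | N | O | T | D

def dP : QP → Bool → QP
  | .N, true => .O
  | .N, false => .D
  | .O, true => .T
  | .O, false => .N
  | .T, true => .D
  | .T, false => .N
  | .D, _ => .D

def fP : QP → Bool
  | .N => false
  | .O => true
  | .T => true
  | .D => false

inductive QA | S | Y | B | C | M | Z | D

def dA : QA → Bool → QA
  | .S, true => .Y
  | .S, false => .B
  | .Y, true => .M
  | .Y, false => .B
  | .B, true => .C
  | .B, false => .D
  | .C, true => .M
  | .C, false => .D
  | .M, true => .D
  | .M, false => .Z
  | .Z, true => .Y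
  | .Z, false => .B
  | .D, _ => .D

def fA : QA → Bool
  | .S => true
  | .Y => true
  | .B => false
  | .C => false
  | .M => true
  | .Z => true
  | .D => false

/-- local conditions; `j` is the last position read -/
def locP (n : ℕ) (c : ℕ → Bool) (j : ℕ) : Prop :=
  ¬ (c (j - 1) = true ∧ c j = true ∧ c (j + 1) = true) ∧
  (j + 1 ≤ n → c (j + 1) = false → c j = true ∧ c (j + 2) = true)

def locA (n : ℕ) (c : ℕ → Bool) (j : ℕ) : Prop :=
  ¬ (c (j - 1) = true ∧ c j = true ∧ c (j + 1) = true) ∧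
  (j + 1 ≤ n → c (j + 1) = false →
    (c (j - 1) = true ∧ c j = true) ∨ (c (j + 2) = true ∧ c (j + 3) = true))

lemma tail_split (R : ℕ → Prop) (i : ℕ) :
    (∀ j, i ≤ j → R j) ↔ R i ∧ ∀ j, i + 1 ≤ j → R j := by
  constructor
  · intro h; exact ⟨h i le_rfl, fun j hj => h j (by omega)⟩
  · rintro ⟨h1, h2⟩ j hj
    rcases Nat.eq_or_lt_of_le hj with rfl | h
    · exact h1
    · exact h2 j h

def ctxP (c : ℕ → Bool) (i : ℕ) : QP → Prop
  | .N => c i = false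
  | .O => c (i - 1) = false ∧ c i = true
  | .T => c (i - 1) = true ∧ c i = true
  | .D => True

def pendP (c : ℕ → Bool) (i : ℕ) : QP → Prop
  | .N => c (i + 1) = true
  | .O => True
  | .T => True
  | .D => False

def ctxA (c : ℕ → Bool) (i : ℕ) : QA → Prop
  | .S => c i = false
  | .Y => c (i - 1) = false ∧ c i = true
  | .B => c i = false
  | .C => c (i - 1) = false ∧ c i = true
  | .M => c (i - 1) = true ∧ c i = true
  | .Z => c i = false
  | .D => True

def pendA (c : ℕ → Bool) (i : ℕ) : QA → Prop
  | .S => True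
  | .Y => True
  | .B => c (i + 1) = true ∧ c (i + 2) = true
  | .C => c (i + 1) = true
  | .M => True
  | .Z => True
  | .D => False

lemma out_false {n : ℕ} {c : ℕ → Bool} (h : InRange n c) (i : ℕ) (hi : n < i) : c i = false := by
  cases hc : c i
  · rfl
  · have := h i hc; omega

lemma zero_false {n : ℕ} {c : ℕ → Bool} (h : InRange n c) : c 0 = false := by
  cases hc : c 0
  · rfl
  · have := h 0 hc; omega

lemma acc_P (n : ℕ) (c : ℕ → Bool) (h : InRange n c) (r : ℕ) : ∀ (q : QP) (i : ℕ), i + r = n →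
    ctxP c i q → (accW dP fP c q i r = true ↔ pendP c i q ∧ ∀ j, i ≤ j → locP n c j) := by
  induction r with
  | zero =>
    intro q i hi hq
    have ht : ∀ j, i ≤ j → locP n c j := by
      intro j hj
      have := out_false h (j + 1) (by omega)
      constructor
      · simp [this]
      · omega
    have h1 := out_false h (i + 1) (by omega)
    cases q <;> simp [accW, fP, pendP, h1] <;> exact ht
  | succ r ih =>
    intro q i hi hq
    rw [tail_split]
    simp only [accW]
    rw [ih]
    · generalize (∀ j, i + 1 ≤ j → locP n c j) = R
      have hi' : i + 1 ≤ n := by omega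
      cases q <;> cases hc : c (i + 1) <;>
        simp_all [dP, pendP, ctxP, locP]
    · omega
    · cases q <;> cases hc : c (i + 1) <;>
        simp_all [dP, ctxP]

lemma acc_A (n : ℕ) (c : ℕ → Bool) (h : InRange n c) (r : ℕ) : ∀ (q : QA) (i : ℕ), i + r = n →
    ctxA c i q → (accW dA fA c q i r = true ↔ pendA c i q ∧ ∀ j, i ≤ j → locA n c j) := by
  induction r with
  | zero =>
    intro q i hi hq
    have ht : ∀ j, i ≤ j → locA n c j := by
      intro j hj
      have := out_false h (j + 1) (by omega)
      constructor
      · simp [this]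
      · omega
    have h1 := out_false h (i + 1) (by omega)
    cases q <;> simp [accW, fA, pendA, h1] <;> exact ht
  | succ r ih =>
    intro q i hi hq
    rw [tail_split]
    simp only [accW]
    rw [ih]
    · generalize (∀ j, i + 1 ≤ j → locA n c j) = R
      have hi' : i + 1 ≤ n := by omega
      cases q <;> cases hc : c (i + 1) <;>
        simp_all [dA, pendA, ctxA, locA]
    · omega
    · cases q <;> cases hc : c (i + 1) <;>
        simp_all [dA, ctxA]

lemma perm_iff (n : ℕ) (c : ℕ → Bool) (h : InRange n c) : Permissible n c ↔
    ∀ j, ¬ (c (j - 1) = true ∧ c j = true ∧ c (j + 1) = true) := by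
  have h0 := zero_false h
  have h1 := out_false h (n + 1) (by omega)
  constructor
  · rintro hp j ⟨a1, a2, a3⟩
    rcases hp j a2 with rfl | rfl | h' | h' <;> simp_all
  · intro hp j hj
    have := hp j
    unfold Sun
    cases ha : c (j - 1) <;> cases hb : c (j + 1) <;> simp_all

lemma char_P (n : ℕ) (c : ℕ → Bool) (h : InRange n c) :
    (IsMaximal n c ∧ ResistPred n c) ↔ ∀ j, 0 ≤ j → locP n c j := by
  have h0 := zero_false h
  have h1 := out_false h (n + 1) (by omega)
  have hs : ∀ j, 1 ≤ j → (¬ Sun n (occupy c j) j ↔ c (j - 1) = true ∧ c (j + 1) = true) := by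
    intro j hj
    have e1 : j - 1 ≠ j := by omega
    simp only [Sun, occupy, e1, if_false]
    constructor
    · intro h'; simp_all
    · rintro ⟨a1, a2⟩ (rfl | rfl | h' | h') <;> simp_all
  unfold locP
  constructor
  · rintro ⟨hm, hr⟩ j _
    refine ⟨(perm_iff n c h).1 hm.1 j, fun hj hc => ?_⟩
    exact (hs (j + 1) (by omega)).1 (hr (j + 1) (by omega) hj hc)
  · intro hl
    have hr : ResistPred n c := by
      intro j hj hjn hc
      rw [hs j hj]
      obtain ⟨j, rfl⟩ : ∃ i, j = i + 1 := ⟨j - 1, by omega⟩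
      exact (hl j (Nat.zero_le _)).2 hjn hc
    refine ⟨⟨(perm_iff n c h).2 fun j => (hl j (Nat.zero_le _)).1, ?_⟩, hr⟩
    intro j hj hjn hc hp
    exact hr j hj hjn hc (hp j (by simp [occupy]))

lemma char_A (n : ℕ) (c : ℕ → Bool) (h : InRange n c) :
    (IsMaximal n c ∧ ResistAlt n c) ↔ ∀ j, 0 ≤ j → locA n c j := by
  have h0 := zero_false h
  have h1 := out_false h (n + 1) (by omega)
  unfold locA
  constructor
  · rintro ⟨hm, hr⟩ j _
    have hp := (perm_iff n c h).1 hm.1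
    refine ⟨hp j, fun hj hc => ?_⟩
    obtain ⟨i, hij, hi, hsun⟩ := hr (j + 1) (by omega) hj hc
    simp only [Sun, occupy, not_or] at hsun
    obtain ⟨s1, s2, s3, s4⟩ := hsun
    have hr := h i hi
    by_cases e1 : i = j
    · subst e1
      left
      refine ⟨?_, hi⟩
      rw [if_neg (by omega)] at s3
      simpa using s3
    · by_cases e2 : i = j + 2
      · subst e2
        right
        refine ⟨hi, ?_⟩
        rw [if_neg (by omega)] at s4
        simpa using s4
      · rw [if_neg (by omega)] at s3 s4
        exact absurd ⟨by simpa using s3, hi, by simpa using s4⟩ (hp i)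
  · intro hl
    have hr : ResistAlt n c := by
      intro j hj hjn hc
      obtain ⟨j, rfl⟩ : ∃ i, j = i + 1 := ⟨j - 1, by omega⟩
      rcases (hl j (Nat.zero_le _)).2 hjn hc with ⟨a, b⟩ | ⟨a, b⟩
      · have ha := h _ a
        refine ⟨j, by omega, b, ?_⟩
        simp only [Sun, occupy, not_or]
        refine ⟨by omega, by omega, ?_, by simp⟩
        rw [if_neg (by omega)]; simp [a]
      · have hb := h _ b
        refine ⟨j + 2, by omega, a, ?_⟩
        simp only [Sun, occupy, not_or]
        refine ⟨by omega, by omega, by simp, ?_⟩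
        rw [if_neg (by omega)]; simp [b]
    refine ⟨⟨(perm_iff n c h).2 fun j => (hl j (Nat.zero_le _)).1, ?_⟩, hr⟩
    intro j hj hjn hc hp
    obtain ⟨i, hij, hi, hsun⟩ := hr j hj hjn hc
    exact hsun (hp i (by simp [occupy, hi]))

lemma JP_eq (k n : ℕ) (hn : 1 ≤ n) : JP k n = (polyW dP fP .N n).coeff k := by
  rw [← card_acc]
  unfold JP
  apply Nat.card_congr
  apply Equiv.subtypeEquivRight
  intro c
  apply and_congr_right
  intro h
  rw [← and_assoc, char_P n c h, acc_P n c h n .N 0 (by omega) (zero_false h)]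
  apply and_congr_left
  intro _
  constructor
  · intro hl
    refine ⟨?_, hl⟩
    have := (hl 0 le_rfl).2 hn
    have h0 := zero_false h
    cases hc : c (0 + 1)
    · have := this hc; simp_all
    · exact hc
  · exact fun hl => hl.2

lemma JA_eq (k n : ℕ) : JA k n = (polyW dA fA .S n).coeff k := by
  rw [← card_acc]
  unfold JA
  apply Nat.card_congr
  apply Equiv.subtypeEquivRight
  intro c
  apply and_congr_right
  intro h
  rw [← and_assoc, char_A n c h, acc_A n c h n .S 0 (by omega) (zero_false h)]
  simp [pendA]

lemma dead_P (n : ℕ) : polyW dP fP .D n = 0 := by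
  induction n with
  | zero => simp [polyW, fP]
  | succ n ih => simp [polyW, dP, ih]

lemma dead_A (n : ℕ) : polyW dA fA .D n = 0 := by
  induction n with
  | zero => simp [polyW, fA]
  | succ n ih => simp [polyW, dA, ih]

open Polynomial in
lemma rec_P (m : ℕ) : polyW dP fP .N (m + 6) = X ^ 2 * polyW dP fP .N (m + 3) +
    X ^ 2 * polyW dP fP .N (m + 2) + X ^ 3 * polyW dP fP .N (m + 1) := by
  have h : ∀ n, polyW dP fP .N (n + 3) = X * polyW dP fP .N (n + 1) + X ^ 2 * polyW dP fP .N n := by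
    intro n
    simp only [polyW, dP, dead_P]
    ring
  rw [h (m + 3), h (m + 1)]
  ring

open Polynomial in
lemma rec_A (m : ℕ) : polyW dA fA .S (m + 6) = X ^ 2 * polyW dA fA .S (m + 3) +
    X ^ 2 * polyW dA fA .S (m + 2) + X ^ 3 * polyW dA fA .S (m + 1) := by
  have h : ∀ n, polyW dA fA .M (n + 5) = X ^ 2 * polyW dA fA .M (n + 2) +
      X ^ 2 * polyW dA fA .M (n + 1) + X ^ 3 * polyW dA fA .M n := by
    intro n
    simp only [polyW, dA, dead_A]
    ring
  have hS : ∀ n, polyW dA fA .S (n + 4) = X ^ 2 * polyW dA fA .M (n + 2) +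
      X ^ 2 * polyW dA fA .M (n + 1) + X ^ 3 * polyW dA fA .M n := by
    intro n
    simp only [polyW, dA, dead_A]
    ring
  match m with
  | 0 => simp [polyW, dA, fA]; ring
  | 1 => simp [polyW, dA, fA]; ring
  | 2 => simp [polyW, dA, fA]; ring
  | m + 3 =>
    rw [hS (m + 5), show m + 3 + 3 = m + 2 + 4 by ring, show m + 3 + 2 = m + 1 + 4 by ring,
      show m + 3 + 1 = m + 4 by ring, hS, hS, hS, show m + 5 + 2 = m + 2 + 5 by ring,
      show m + 5 + 1 = m + 1 + 5 by ring, h, h, h]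

end aux

/-- `J^P` and `J^A` satisfy the same three-term recurrence. -/
theorem stmt7 (n k : ℕ) (hn : 6 ≤ n) (hk : 3 ≤ k) :
    JP k n = JP (k - 2) (n - 3) + JP (k - 2) (n - 4) + JP (k - 3) (n - 5) ∧
    JA k n = JA (k - 2) (n - 3) + JA (k - 2) (n - 4) + JA (k - 3) (n - 5) := by
  obtain ⟨m, rfl⟩ : ∃ m, n = m + 6 := ⟨n - 6, by omega⟩
  obtain ⟨l, rfl⟩ : ∃ l, k = l + 3 := ⟨k - 3, by omega⟩
  have e1 : m + 6 - 3 = m + 3 := by omega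
  have e2 : m + 6 - 4 = m + 2 := by omega
  have e3 : m + 6 - 5 = m + 1 := by omega
  have e4 : l + 3 - 2 = l + 1 := by omega
  have e5 : l + 3 - 3 = l := by omega
  rw [e1, e2, e3, e4, e5]
  have c2 : ∀ p : Polynomial ℕ, (Polynomial.X ^ 2 * p).coeff (l + 3) = p.coeff (l + 1) :=
    fun p => Polynomial.coeff_X_pow_mul p 2 (l + 1)
  have c3 : ∀ p : Polynomial ℕ, (Polynomial.X ^ 3 * p).coeff (l + 3) = p.coeff l :=
    fun p => Polynomial.coeff_X_pow_mul p 3 l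
  constructor
  · rw [JP_eq _ _ (by omega), JP_eq _ _ (by omega), JP_eq _ _ (by omega), JP_eq _ _ (by omega),
      rec_P, Polynomial.coeff_add, Polynomial.coeff_add, c2, c2, c3]
  · rw [JA_eq, JA_eq, JA_eq, JA_eq,
      rec_A, Polynomial.coeff_add, Polynomial.coeff_add, c2, c2, c3]
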